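/- arXiv:math/0102168 — 3 statements merged into one kernel-verified Lean document; each statement's English description precedes it below -/
import Mathlib

section
/- Let y, w ∈ S_n with y ≤ w, and let t ∈ T be a transposition with l(yt) < l(y). Then there exists an injective map from R(y,w) into R(yt,w) \ {t}. -/
open scoped Classical

namespace BSW

/-- The number of inversions (the length) of a permutation of `Fin n`. -/
def invLen {n : ℕ} (w : Equiv.Perm (Fin n)) : ℕ :=
  (Finset.univ.filter (fun p : Fin n × Fin n => p.1 < p.2 ∧ w p.2 < w p.1)).card

/-- The rank function `r_w(p,q) = #{i : 1 ≤ i ≤ p and w(i) ≥ q}`, where the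
permutation of `Fin n` is regarded as a permutation of `{1,…,n}` (so position
`i : Fin n` corresponds to `i+1` and value `w i` to `(w i)+1`). -/
def rank {n : ℕ} (w : Equiv.Perm (Fin n)) (p q : ℤ) : ℕ :=
  (Finset.univ.filter (fun i : Fin n =>
    ((i : ℕ) : ℤ) + 1 ≤ p ∧ q ≤ ((w i : ℕ) : ℤ) + 1)).card

/-- The difference function `d_{x,w}(p,q) = r_w(p,q) − r_x(p,q)`. -/
def dxw {n : ℕ} (x w : Equiv.Perm (Fin n)) (p q : ℤ) : ℤ :=
  (rank w p q : ℤ) - (rank x p q : ℤ)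

/-- The Bruhat order: `x ≤ w` iff `d_{x,w}` is everywhere non-negative. -/
def bruhatLE {n : ℕ} (x w : Equiv.Perm (Fin n)) : Prop :=
  ∀ p q : ℤ, 0 ≤ dxw x w p q

/-- The set of transpositions in `S_n`. -/
def transpositions (n : ℕ) : Set (Equiv.Perm (Fin n)) :=
  {t | ∃ a b : Fin n, a ≠ b ∧ t = Equiv.swap a b}

/-- `R(x,w) = {t ∈ T : l(xt) > l(x) and xt ≤ w}`. -/
def R {n : ℕ} (x w : Equiv.Perm (Fin n)) : Set (Equiv.Perm (Fin n)) :=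
  {t | t ∈ transpositions n ∧ invLen x < invLen (x * t) ∧ bruhatLE (x * t) w}

/-- `x` is a maximal singular point (MSP) for `w`. -/
def MSP {n : ℕ} (x w : Equiv.Perm (Fin n)) : Prop :=
  bruhatLE x w ∧ ((invLen w : ℤ) - (invLen x : ℤ) < ((R x w).ncard : ℤ)) ∧
    ∀ t ∈ R x w, ((R (x * t) w).ncard : ℤ) = (invLen w : ℤ) - (invLen (x * t) : ℤ)

/-- `Δ(x,w) = {i : t_{{i,j}} ∈ R(x,w) for some j}`. -/
def Delta {n : ℕ} (x w : Equiv.Perm (Fin n)) : Set (Fin n) :=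
  {i | ∃ j : Fin n, Equiv.swap i j ∈ R x w}

/-- `Δ(x,w)` as a finset. -/
noncomputable def DeltaFinset {n : ℕ} (x w : Equiv.Perm (Fin n)) : Finset (Fin n) :=
  (Set.toFinite (Delta x w)).toFinset

/-- `σ ∈ S_k` is the flattening of `x` along the increasing enumeration `d_1 < … < d_k`
of a set `D` of positions with `#D = k`: the unique permutation of `{1,…,k}` with
`σ(a) < σ(b)` iff `x(d_a) < x(d_b)`. -/
def IsFlatteningOn {n k : ℕ} (x : Equiv.Perm (Fin n)) (D : Finset (Fin n))
    (hD : D.card = k) (σ : Equiv.Perm (Fin k)) : Prop :=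
  ∀ a b : Fin k, σ a < σ b ↔ x ((D.orderIsoOfFin hD a : Fin n)) < x ((D.orderIsoOfFin hD b : Fin n))

/-- Values (0-indexed) of the permutation `x_{k,m} = [k,…,1, k+m,…,k+1]`. -/
def xkmVal (k m i : ℕ) : ℕ :=
  if i < k then k - 1 - i else 2 * k + m - 1 - i

/-- Values (0-indexed) of the permutation `w_{k,m} = [k+m, k,…,2, k+m−1,…,k+1, 1]`. -/
def wkmVal (k m i : ℕ) : ℕ :=
  if i = 0 then k + m - 1
  else if i < k then k - i
  else if i < k + m - 1 then 2 * k + m - 2 - i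
  else 0

/-- Values (0-indexed) of the permutation `x_{k,l,m} = [k,…,1, k+l,…,k+1, k+l+m,…,k+l+1]`. -/
def xklmVal (k l m i : ℕ) : ℕ :=
  if i < k then k - 1 - i
  else if i < k + l then 2 * k + l - 1 - i
  else 2 * (k + l) + m - 1 - i

/-- Values (0-indexed) of the permutation
`w_{k,l,m} = [k+l, k,…,2, k+l+m, k+l−1,…,k+2, 1, k+l+m−1,…,k+l+1, k+1]`. -/
def wklmVal (k l m i : ℕ) : ℕ :=
  if i = 0 then k + l - 1
  else if i < k then k - i
  else if i = k then k + l + m - 1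
  else if i < k + l - 1 then 2 * k + l - 1 - i
  else if i = k + l - 1 then 0
  else if i < k + l + m - 1 then 2 * (k + l) + m - 2 - i
  else k


/-- Membership of the matrix position `(i, v)` in the quadrant counted by `rank _ p q`. -/
def cell {n : ℕ} (p q : ℤ) (i v : Fin n) : ℕ :=
  if ((i : ℕ) : ℤ) + 1 ≤ p ∧ q ≤ ((v : ℕ) : ℤ) + 1 then 1 else 0

theorem rank_eq_sum_cell {n : ℕ} (w : Equiv.Perm (Fin n)) (p q : ℤ) :
    rank w p q = ∑ i, cell p q i (w i) := by
  simp only [rank, cell, Finset.card_filter]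

theorem rank_eq_add_cell {n : ℕ} (w : Equiv.Perm (Fin n)) (p q : ℤ) {a b c : Fin n}
    (hab : a ≠ b) (hac : a ≠ c) (hbc : b ≠ c) :
    rank w p q = cell p q a (w a) + cell p q b (w b) + cell p q c (w c) +
      ∑ i ∈ Finset.univ \ {a, b, c}, cell p q i (w i) := by
  rw [rank_eq_sum_cell, ← Finset.sum_sdiff (Finset.subset_univ {a, b, c}), add_comm,
    Finset.sum_insert (by simp [hab, hac]), Finset.sum_insert (by simp [hbc]),
    Finset.sum_singleton]
  ring

/-- A permutation lies below `w` if it agrees outside three positions with `v₁, v₂ ≤ w` and its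
rank function is pointwise bounded by theirs on these positions. -/
theorem bruhatLE_of_cell_le {n : ℕ} {u v₁ v₂ w : Equiv.Perm (Fin n)} {a b c : Fin n}
    (hab : a ≠ b) (hac : a ≠ c) (hbc : b ≠ c)
    (h₁ : ∀ i, i ≠ a → i ≠ b → i ≠ c → u i = v₁ i)
    (h₂ : ∀ i, i ≠ a → i ≠ b → i ≠ c → u i = v₂ i)
    (hv₁ : bruhatLE v₁ w) (hv₂ : bruhatLE v₂ w)
    (h : ∀ p q, cell p q a (u a) + cell p q b (u b) + cell p q c (u c) ≤
        cell p q a (v₁ a) + cell p q b (v₁ b) + cell p q c (v₁ c) ∨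
      cell p q a (u a) + cell p q b (u b) + cell p q c (u c) ≤
        cell p q a (v₂ a) + cell p q b (v₂ b) + cell p q c (v₂ c)) :
    bruhatLE u w := by
  intro p q
  have e₁ := hv₁ p q
  have e₂ := hv₂ p q
  have s₁ : ∑ i ∈ Finset.univ \ {a, b, c}, cell p q i (u i) =
      ∑ i ∈ Finset.univ \ {a, b, c}, cell p q i (v₁ i) :=
    Finset.sum_congr rfl fun i hi => by
      simp only [Finset.mem_sdiff, Finset.mem_insert, Finset.mem_singleton, not_or] at hi
      rw [h₁ i hi.2.1 hi.2.2.1 hi.2.2.2]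
  have s₂ : ∑ i ∈ Finset.univ \ {a, b, c}, cell p q i (u i) =
      ∑ i ∈ Finset.univ \ {a, b, c}, cell p q i (v₂ i) :=
    Finset.sum_congr rfl fun i hi => by
      simp only [Finset.mem_sdiff, Finset.mem_insert, Finset.mem_singleton, not_or] at hi
      rw [h₂ i hi.2.1 hi.2.2.1 hi.2.2.2]
  have := h p q
  unfold dxw at *
  rw [rank_eq_add_cell u p q hab hac hbc]
  rw [rank_eq_add_cell v₁ p q hab hac hbc] at e₁
  rw [rank_eq_add_cell v₂ p q hab hac hbc] at e₂
  omega

theorem bruhatLE_trans {n : ℕ} {u v w : Equiv.Perm (Fin n)} (huv : bruhatLE u v)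
    (hvw : bruhatLE v w) : bruhatLE u w := by
  intro p q
  have h₁ := huv p q
  have h₂ := hvw p q
  unfold dxw at *
  omega

theorem bruhatLE_mul_swap {n : ℕ} {x : Equiv.Perm (Fin n)} {a b : Fin n} (hab : a < b)
    (hx : x a < x b) : bruhatLE x (x * Equiv.swap a b) := by
  intro p q
  have rank_split : ∀ v : Equiv.Perm (Fin n), rank v p q = cell p q a (v a) + cell p q b (v b) +
      ∑ i ∈ Finset.univ \ {a, b}, cell p q i (v i) := fun v => by
    rw [rank_eq_sum_cell, ← Finset.sum_sdiff (Finset.subset_univ {a, b}), add_comm,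
      Finset.sum_pair hab.ne]
  have hs : ∑ i ∈ Finset.univ \ {a, b}, cell p q i ((x * Equiv.swap a b) i) =
      ∑ i ∈ Finset.univ \ {a, b}, cell p q i (x i) :=
    Finset.sum_congr rfl fun i hi => by
      simp only [Finset.mem_sdiff, Finset.mem_insert, Finset.mem_singleton, not_or] at hi
      rw [Equiv.Perm.mul_apply, Equiv.swap_apply_of_ne_of_ne hi.2.1 hi.2.2]
  unfold dxw
  rw [rank_split x, rank_split, hs]
  simp only [Equiv.Perm.mul_apply, Equiv.swap_apply_left, Equiv.swap_apply_right, cell]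
  rw [Fin.lt_def] at hab hx
  split_ifs <;> omega

theorem invLen_lt_mul_swap {n : ℕ} {x : Equiv.Perm (Fin n)} {a b : Fin n} (hab : a < b)
    (hx : x a < x b) : invLen x < invLen (x * Equiv.swap a b) := by
  set t := Equiv.swap a b with ht
  have htt : ∀ i, t (t i) = i := Equiv.swap_apply_self a b
  have hta : t a = b := Equiv.swap_apply_left a b
  have htb : t b = a := Equiv.swap_apply_right a b
  have hto : ∀ i, i ≠ a → i ≠ b → t i = i := fun i => Equiv.swap_apply_of_ne_of_ne
  let f : Fin n × Fin n → Fin n × Fin n := fun r =>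
    if t r.1 < t r.2 then (t r.1, t r.2) else r
  refine lt_of_le_of_lt (Finset.card_le_card_of_injOn
    (t := (Finset.univ.filter fun r : Fin n × Fin n =>
      r.1 < r.2 ∧ (x * t) r.2 < (x * t) r.1).erase (a, b)) f ?_ ?_) (Finset.card_erase_lt_of_mem ?_)
  · rintro ⟨i, j⟩ h
    simp only [Finset.coe_filter, Finset.mem_univ, true_and, Set.mem_ofPred_eq] at h
    simp only [Finset.coe_erase, f]
    split_ifs <;>
    simp only [Set.mem_sdiff, Set.mem_singleton_iff, Prod.mk.injEq, Equiv.Perm.mul_apply] <;>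
    grind
  · rintro ⟨i, j⟩ h ⟨k, l⟩ h' e
    simp only [Finset.coe_filter, Finset.mem_univ, true_and, Set.mem_ofPred_eq] at h h'
    simp only [f] at e
    grind
  · rw [Finset.mem_filter]
    simp [hab, hta, htb, hx]

theorem invLen_lt_mul_swap_iff {n : ℕ} {x : Equiv.Perm (Fin n)} {a b : Fin n} (hab : a < b) :
    invLen x < invLen (x * Equiv.swap a b) ↔ x a < x b := by
  refine ⟨fun h => ?_, invLen_lt_mul_swap hab⟩
  by_contra hx
  have hne : x a ≠ x b := x.injective.ne hab.ne
  have := invLen_lt_mul_swap (x := x * Equiv.swap a b) hab (by simp; grind)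
  rw [mul_assoc, Equiv.swap_mul_self, mul_one] at this
  omega

theorem swap_mem_R_iff {n : ℕ} {x w : Equiv.Perm (Fin n)} {a b : Fin n} (hab : a ≠ b) :
    Equiv.swap a b ∈ R x w ↔
      (a < b ∧ x a < x b ∨ b < a ∧ x b < x a) ∧ bruhatLE (x * Equiv.swap a b) w := by
  have ht : Equiv.swap a b ∈ transpositions n := ⟨a, b, hab, rfl⟩
  simp only [R, Set.mem_ofPred_eq, ht, true_and]
  rcases hab.lt_or_gt with h | h
  · simp [invLen_lt_mul_swap_iff h, h, h.not_gt]
  · rw [Equiv.swap_comm, invLen_lt_mul_swap_iff h]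
    simp [h, h.not_gt]

section

variable {n : ℕ} {y w : Equiv.Perm (Fin n)} {a b c : Fin n}

theorem swap_mem_R_mul_swap_of_disjoint {d : Fin n} (hab : a < b) (hy : y b < y a)
    (hca : c ≠ a) (hcb : c ≠ b) (hda : d ≠ a) (hdb : d ≠ b) (hcd : c ≠ d)
    (h : Equiv.swap c d ∈ R y w) : Equiv.swap c d ∈ R (y * Equiv.swap a b) w := by
  rw [swap_mem_R_iff hcd] at h ⊢
  simp only [Equiv.Perm.mul_apply, Equiv.swap_apply_of_ne_of_ne hca hcb,
    Equiv.swap_apply_of_ne_of_ne hda hdb]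
  refine ⟨h.1, bruhatLE_trans ?_ h.2⟩
  have hcomm : Equiv.swap a b * Equiv.swap c d = Equiv.swap c d * Equiv.swap a b :=
    Equiv.Perm.Disjoint.commute (Equiv.Perm.disjoint_swap_swap (by simp [*, hab.ne, hca.symm,
      hcb.symm, hda.symm, hdb.symm]))
  have key := bruhatLE_mul_swap (x := y * Equiv.swap c d * Equiv.swap a b) hab (by
    simp [Equiv.swap_apply_of_ne_of_ne hca.symm hda.symm,
      Equiv.swap_apply_of_ne_of_ne hcb.symm hdb.symm, hy])
  rwa [Equiv.mul_swap_mul_self, mul_assoc, ← hcomm, ← mul_assoc] at key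

theorem mul_swap_mul_swap_bruhatLE (hab : a ≠ b) (hac : a ≠ c) (hbc : b ≠ c)
    {v₁ v₂ : Equiv.Perm (Fin n)} (hv₁ : v₁ = y * Equiv.swap a c ∨ v₁ = y * Equiv.swap b c)
    (hv₂ : v₂ = y * Equiv.swap a c ∨ v₂ = y * Equiv.swap b c)
    (h₁ : bruhatLE v₁ w) (h₂ : bruhatLE v₂ w) :
    ((∀ p q, cell p q a (y c) + cell p q b (y a) + cell p q c (y b) ≤
        cell p q a (v₁ a) + cell p q b (v₁ b) + cell p q c (v₁ c) ∨
      cell p q a (y c) + cell p q b (y a) + cell p q c (y b) ≤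
        cell p q a (v₂ a) + cell p q b (v₂ b) + cell p q c (v₂ c)) →
      bruhatLE (y * Equiv.swap a b * Equiv.swap a c) w) ∧
    ((∀ p q, cell p q a (y b) + cell p q b (y c) + cell p q c (y a) ≤
        cell p q a (v₁ a) + cell p q b (v₁ b) + cell p q c (v₁ c) ∨
      cell p q a (y b) + cell p q b (y c) + cell p q c (y a) ≤
        cell p q a (v₂ a) + cell p q b (v₂ b) + cell p q c (v₂ c)) →
      bruhatLE (y * Equiv.swap a b * Equiv.swap b c) w) := by
  have off : ∀ i, i ≠ a → i ≠ b → i ≠ c → v₁ i = y i ∧ v₂ i = y i ∧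
      (y * Equiv.swap a b * Equiv.swap a c) i = y i ∧
      (y * Equiv.swap a b * Equiv.swap b c) i = y i := fun i ia ib ic => by
    rcases hv₁ with rfl | rfl <;> rcases hv₂ with rfl | rfl <;>
      simp [Equiv.swap_apply_of_ne_of_ne, ia, ib, ic]
  refine ⟨fun h => ?_, fun h => ?_⟩ <;>
    refine bruhatLE_of_cell_le hab hac hbc (fun i ia ib ic => ?_) (fun i ia ib ic => ?_)
      h₁ h₂ fun p q => ?_
  · exact (off i ia ib ic).2.2.1.trans (off i ia ib ic).1.symm
  · exact (off i ia ib ic).2.2.1.trans (off i ia ib ic).2.1.symm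
  · simpa [Equiv.swap_apply_of_ne_of_ne, hab.symm, hac.symm, hbc.symm, hab, hac, hbc] using h p q
  · exact (off i ia ib ic).2.2.2.trans (off i ia ib ic).1.symm
  · exact (off i ia ib ic).2.2.2.trans (off i ia ib ic).2.1.symm
  · simpa [Equiv.swap_apply_of_ne_of_ne, hab.symm, hac.symm, hbc.symm, hab, hac, hbc] using h p q

/-- The indicator of a quadrant is a product of indicators of half-lines. -/
theorem cell_eq_mul (p q : ℤ) (i v : Fin n) : cell p q i v =
    (if ((i : ℕ) : ℤ) + 1 ≤ p then 1 else 0) * (if q ≤ ((v : ℕ) : ℤ) + 1 then 1 else 0) := by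
  simp only [cell]
  split_ifs <;> simp_all

theorem cell_add_cell_le {i j u v : Fin n} (hij : i < j) (huv : u < v) (p q : ℤ) :
    cell p q i u + cell p q j v ≤ cell p q i v + cell p q j u := by
  rw [Fin.lt_def] at hij huv
  simp only [cell]
  split_ifs <;> omega

theorem swap_mem_R_mul_swap_of_adjacent (hab : a < b) (hy : y b < y a)
    (hac : a ≠ c) (hbc : b ≠ c) (h : Equiv.swap a c ∈ R y w ∨ Equiv.swap b c ∈ R y w) :
    Equiv.swap a c ∈ R (y * Equiv.swap a b) w ∨ Equiv.swap b c ∈ R (y * Equiv.swap a b) w := by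
  simp only [swap_mem_R_iff hac, swap_mem_R_iff hbc] at h ⊢
  have ac := y.injective.ne hac
  have bc := y.injective.ne hbc
  have va : (y * Equiv.swap a b) a = y b := by simp
  have vb : (y * Equiv.swap a b) b = y a := by simp
  have vc : (y * Equiv.swap a b) c = y c := by
    simp [Equiv.swap_apply_of_ne_of_ne hac.symm hbc.symm]
  rw [va, vb, vc]
  rcases h with ⟨hlt, hle⟩ | ⟨hlt, hle⟩
  · obtain ⟨k₁, k₂⟩ := mul_swap_mul_swap_bruhatLE hab.ne hac hbc (.inl rfl) (.inl rfl) hle hle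
    simp only [or_self, Equiv.Perm.mul_apply, Equiv.swap_apply_left, Equiv.swap_apply_right,
      Equiv.swap_apply_of_ne_of_ne hab.ne' hbc] at k₁ k₂
    by_cases h' : b < c ∨ c < a ∧ y b < y c
    · refine .inr ⟨by grind, k₂ fun p q => ?_⟩
      have := cell_add_cell_le hab (show y b < y c by grind) p q
      omega
    · refine .inl ⟨by grind, k₁ fun p q => ?_⟩
      have := cell_add_cell_le (show c < b by grind) hy p q
      omega
  · obtain ⟨k₁, k₂⟩ := mul_swap_mul_swap_bruhatLE hab.ne hac hbc (.inr rfl) (.inr rfl) hle hle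
    simp only [or_self, Equiv.Perm.mul_apply, Equiv.swap_apply_left, Equiv.swap_apply_right,
      Equiv.swap_apply_of_ne_of_ne hab.ne hac] at k₁ k₂
    by_cases h' : c < a ∨ b < c ∧ y c < y a
    · refine .inl ⟨by grind, k₁ fun p q => ?_⟩
      have := cell_add_cell_le hab (show y c < y a by grind) p q
      omega
    · refine .inr ⟨by grind, k₂ fun p q => ?_⟩
      have := cell_add_cell_le (show a < c by grind) hy p q
      omega

theorem swap_mem_R_mul_swap_of_both (hab : a < b) (hy : y b < y a)
    (hac : a ≠ c) (hbc : b ≠ c) (h₁ : Equiv.swap a c ∈ R y w) (h₂ : Equiv.swap b c ∈ R y w) :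
    Equiv.swap a c ∈ R (y * Equiv.swap a b) w ∧ Equiv.swap b c ∈ R (y * Equiv.swap a b) w := by
  simp only [swap_mem_R_iff hac, swap_mem_R_iff hbc] at h₁ h₂ ⊢
  have va : (y * Equiv.swap a b) a = y b := by simp
  have vb : (y * Equiv.swap a b) b = y a := by simp
  have vc : (y * Equiv.swap a b) c = y c := by
    simp [Equiv.swap_apply_of_ne_of_ne hac.symm hbc.symm]
  rw [va, vb, vc]
  obtain ⟨k₁, k₂⟩ :=
    mul_swap_mul_swap_bruhatLE hab.ne hac hbc (.inl rfl) (.inr rfl) h₁.2 h₂.2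
  simp only [Equiv.Perm.mul_apply, Equiv.swap_apply_left, Equiv.swap_apply_right,
    Equiv.swap_apply_of_ne_of_ne hab.ne hac, Equiv.swap_apply_of_ne_of_ne hab.ne' hbc] at k₁ k₂
  refine ⟨⟨by grind, k₁ fun p q => ?_⟩, by grind, k₂ fun p q => ?_⟩ <;>
  · have hc : c < a ∧ y c < y b ∨ b < c ∧ y a < y c := by grind
    simp only [Fin.lt_def] at hab hy hc
    simp only [cell_eq_mul]
    by_cases ha : ((a : ℕ) : ℤ) + 1 ≤ p <;> by_cases hb : ((b : ℕ) : ℤ) + 1 ≤ p <;>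
      by_cases hc : ((c : ℕ) : ℤ) + 1 ≤ p <;> simp only [ha, hb, hc, if_true, if_false] <;>
      split_ifs <;> omega

end

/-- If `y ≤ w` and `t` is a transposition with `l(yt) < l(y)`, then there is an
injective map from `R(y,w)` into `R(yt,w) \ {t}`. -/
theorem exists_injective_R_map {n : ℕ} (y w : Equiv.Perm (Fin n)) (hyw : bruhatLE y w)
    (t : Equiv.Perm (Fin n)) (ht : t ∈ transpositions n)
    (hlt : invLen (y * t) < invLen y) :
    ∃ f : R y w → ↥(R (y * t) w \ {t}), Function.Injective f := by
  classical
  obtain ⟨a, b, hab, rfl⟩ : ∃ a b : Fin n, a < b ∧ t = Equiv.swap a b := by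
    obtain ⟨a, b, hne, rfl⟩ := ht
    rcases hne.lt_or_gt with h | h
    exacts [⟨a, b, h, rfl⟩, ⟨b, a, h, Equiv.swap_comm a b⟩]
  have hy : y b < y a := by
    have hne := y.injective.ne hab.ne
    have := (invLen_lt_mul_swap_iff (x := y) hab).not.1 hlt.not_gt
    grind
  set t := Equiv.swap a b with ht_def
  have htt : t * t = 1 := Equiv.swap_mul_self a b
  have hself : t ∉ R y w := fun h => (h.2.1.trans hlt).false
  have hca : ∀ c, a ≠ c → b ≠ c → t * Equiv.swap a c * t = Equiv.swap b c := fun c ha hb => by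
    have := Equiv.swap_apply_apply t a c
    rw [Equiv.swap_inv] at this
    rw [← this, ht_def, Equiv.swap_apply_left, Equiv.swap_apply_of_ne_of_ne ha.symm hb.symm]
  have hcb : ∀ c, a ≠ c → b ≠ c → t * Equiv.swap b c * t = Equiv.swap a c := fun c ha hb => by
    rw [← hca c ha hb]
    simp only [mul_assoc, htt, mul_one]
    rw [← mul_assoc, htt, one_mul]
  have mem_or_adjacent : ∀ s ∈ R y w, s ∈ R (y * t) w ∨
      ∃ c, a ≠ c ∧ b ≠ c ∧ (s = Equiv.swap a c ∨ s = Equiv.swap b c) := by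
    intro s hs
    obtain ⟨c, d, hcd, rfl⟩ := hs.1
    by_cases h : c ≠ a ∧ c ≠ b ∧ d ≠ a ∧ d ≠ b
    · exact .inl (swap_mem_R_mul_swap_of_disjoint hab hy h.1 h.2.1 h.2.2.1 h.2.2.2 hcd hs)
    · have h₁ : ¬(c = a ∧ d = b) := by
        rintro ⟨rfl, rfl⟩
        exact hself hs
      have h₂ : ¬(c = b ∧ d = a) := by
        rintro ⟨rfl, rfl⟩
        exact hself (ht_def ▸ Equiv.swap_comm d c ▸ hs)
      right
      by_cases hc : c = a ∨ c = b
      · exact ⟨d, by grind, by grind, hc.imp (fun e => by rw [e]) (fun e => by rw [e])⟩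
      · refine ⟨c, by grind, by grind, ?_⟩
        rw [Equiv.swap_comm c d]
        exact (show d = a ∨ d = b by grind).imp (fun e => by rw [e]) (fun e => by rw [e])
  have exists_mem : ∀ s ∈ R y w, s ∈ R (y * t) w ∨ t * s * t ∈ R (y * t) w := by
    intro s hs
    rcases mem_or_adjacent s hs with h | ⟨c, ha, hb, rfl | rfl⟩
    · exact Or.inl h
    · rw [hca c ha hb]
      exact swap_mem_R_mul_swap_of_adjacent hab hy ha hb (Or.inl hs)
    · rw [hcb c ha hb]
      exact (swap_mem_R_mul_swap_of_adjacent hab hy ha hb (Or.inr hs)).symm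
  have mem_of_both : ∀ s ∈ R y w, t * s * t ∈ R y w → s ∈ R (y * t) w := by
    intro s hs hs'
    rcases mem_or_adjacent s hs with h | ⟨c, ha, hb, rfl | rfl⟩
    · exact h
    · rw [hca c ha hb] at hs'
      exact (swap_mem_R_mul_swap_of_both hab hy ha hb hs hs').1
    · rw [hcb c ha hb] at hs'
      exact (swap_mem_R_mul_swap_of_both hab hy ha hb hs' hs).2
  have hinv : ∀ s, t * (t * s * t) * t = s := fun s => by
    simp only [mul_assoc, htt, mul_one]
    rw [← mul_assoc, htt, one_mul]
  have hne : ∀ s ∈ R y w, s ≠ t ∧ t * s * t ≠ t := fun s hs =>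
    ⟨fun h => hself (h ▸ hs), fun h => hself (by
      have := hinv s
      rw [h, htt, one_mul] at this
      exact this ▸ hs)⟩
  refine ⟨fun s => if h : (s : Equiv.Perm (Fin n)) ∈ R (y * t) w
    then ⟨s, h, (hne s s.2).1⟩
    else ⟨t * s * t, (exists_mem s s.2).resolve_left h, (hne s s.2).2⟩, ?_⟩
  rintro ⟨s, hs⟩ ⟨s', hs'⟩ e
  replace e := congrArg Subtype.val e
  by_cases h : s ∈ R (y * t) w <;> by_cases h' : s' ∈ R (y * t) w <;>
    simp only [h, h', dif_pos, dif_neg, not_false_eq_true, Subtype.mk.injEq] at e ⊢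
  · exact e
  · exact absurd (mem_of_both s' hs' (e ▸ hs)) h'
  · exact absurd (mem_of_both s hs (e ▸ hs')) h
  · rw [← hinv s, e, hinv]

end BSW
end

section
/- Let y, w ∈ S_n with y ≤ w, and let t ∈ T be a transposition with l(yt) < l(y). Then Δ(y,w) ⊆ Δ(yt,w). -/
open scoped Classical

namespace BSW

/-- Positions `u` and `v` are not inverted by `z`. -/
def NonInv {n : ℕ} (z : Equiv.Perm (Fin n)) (u v : Fin n) : Prop :=
  (u < v ∧ z u < z v) ∨ (v < u ∧ z v < z u)

theorem NonInv.symm {n : ℕ} {z : Equiv.Perm (Fin n)} {u v : Fin n} (h : NonInv z u v) :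
    NonInv z v u :=
  Or.symm h

theorem nonInv_mul_swap {n : ℕ} {z : Equiv.Perm (Fin n)} {u v : Fin n} (huv : u ≠ v)
    (h : ¬ NonInv z u v) : NonInv (z * Equiv.swap u v) u v := by
  have hz : z u ≠ z v := fun e => huv (z.injective e)
  simp only [NonInv, Equiv.Perm.mul_apply, Equiv.swap_apply_left, Equiv.swap_apply_right] at h ⊢
  omega

theorem invLen_lt_mul_swap_of_lt {n : ℕ} {z : Equiv.Perm (Fin n)} {u v : Fin n}
    (huv : u < v) (hz : z u < z v) : invLen z < invLen (z * Equiv.swap u v) := by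
  unfold invLen
  set s := Equiv.swap u v with hs
  have hss : ∀ a, s (s a) = a := Equiv.swap_apply_self u v
  have hcases : ∀ a, s a = if a = u then v else if a = v then u else a :=
    Equiv.swap_apply_def u v
  let f : Fin n × Fin n → Fin n × Fin n := fun p =>
    if s p.1 < s p.2 then (s p.1, s p.2) else p
  have hinj : Set.InjOn f
      (Finset.univ.filter (fun p : Fin n × Fin n => p.1 < p.2 ∧ z p.2 < z p.1)) := by
    rintro ⟨a, b⟩ hab ⟨c, d⟩ hcd h
    simp only [Finset.coe_filter, Finset.mem_univ, true_and, Set.mem_ofPred_eq] at hab hcd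
    simp only [f] at h
    grind
  rw [← Finset.card_image_of_injOn hinj]
  apply Finset.card_lt_card
  rw [Finset.ssubset_iff_of_subset]
  · refine ⟨(u, v), ?_, ?_⟩
    · simp [hs, huv, hz]
    · simp only [Finset.mem_image, Finset.mem_filter, Finset.mem_univ, true_and, not_exists,
        not_and, Prod.forall, f]
      grind
  · intro p hp
    simp only [Finset.mem_image, Finset.mem_filter, Finset.mem_univ, true_and, Prod.exists,
      f] at hp
    rw [Finset.mem_filter]
    simp only [Finset.mem_univ, true_and, Equiv.Perm.mul_apply]
    obtain ⟨a, b, ⟨hab, hzab⟩, rfl⟩ := hp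
    split_ifs with h
    · exact ⟨h, by simpa only [hss] using hzab⟩
    · refine ⟨hab, ?_⟩
      have h1 := hcases a
      have h2 := hcases b
      simp only at h ⊢ hab hzab
      grind

theorem invLen_lt_mul_swap_s12 {n : ℕ} {z : Equiv.Perm (Fin n)} {u v : Fin n}
    (h : NonInv z u v) : invLen z < invLen (z * Equiv.swap u v) := by
  rcases h with ⟨h, hz⟩ | ⟨h, hz⟩
  · exact invLen_lt_mul_swap_of_lt h hz
  · rw [Equiv.swap_comm]
    exact invLen_lt_mul_swap_of_lt h hz

theorem nonInv_of_invLen_lt {n : ℕ} {z : Equiv.Perm (Fin n)} {u v : Fin n}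
    (h : invLen z < invLen (z * Equiv.swap u v)) : NonInv z u v := by
  by_contra hn
  have huv : u ≠ v := by
    rintro rfl
    simp [Equiv.swap_self, ← Equiv.Perm.one_def] at h
  have := invLen_lt_mul_swap_s12 (nonInv_mul_swap huv hn)
  rw [mul_assoc, Equiv.swap_mul_self, mul_one] at this
  omega

theorem bruhatLE_mul_swap_of_lt {n : ℕ} {z : Equiv.Perm (Fin n)} {u v : Fin n}
    (huv : u < v) (hz : z u < z v) : bruhatLE z (z * Equiv.swap u v) := by
  intro p q
  unfold dxw
  rw [sub_nonneg, Nat.cast_le]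
  unfold rank
  set s := Equiv.swap u v with hs
  have hss : ∀ a, s (s a) = a := Equiv.swap_apply_self u v
  have hcases : ∀ a, s a = if a = u then v else if a = v then u else a :=
    Equiv.swap_apply_def u v
  by_cases hv : ((v : ℕ) : ℤ) + 1 ≤ p
  · apply Finset.card_le_card_of_injOn s _ s.injective.injOn
    intro a ha
    rw [Finset.mem_coe, Finset.mem_filter] at ha ⊢
    simp only [Finset.mem_univ, true_and, Equiv.Perm.mul_apply, hss] at ha ⊢
    refine ⟨?_, ha.2⟩
    rw [hcases]
    split_ifs <;> omega
  · apply Finset.card_le_card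
    intro a ha
    rw [Finset.mem_filter] at ha ⊢
    simp only [Finset.mem_univ, true_and, Equiv.Perm.mul_apply] at ha ⊢
    refine ⟨ha.1, ?_⟩
    rw [hcases]
    split_ifs with h1 h2
    · subst h1; omega
    · subst h2; omega
    · exact ha.2

theorem bruhatLE_mul_swap_s12 {n : ℕ} {z : Equiv.Perm (Fin n)} {u v : Fin n}
    (h : NonInv z u v) : bruhatLE z (z * Equiv.swap u v) := by
  rcases h with ⟨h, hz⟩ | ⟨h, hz⟩
  · exact bruhatLE_mul_swap_of_lt h hz
  · rw [Equiv.swap_comm]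
    exact bruhatLE_mul_swap_of_lt h hz

theorem mul_swap_bruhatLE {n : ℕ} {z : Equiv.Perm (Fin n)} {u v : Fin n} (huv : u ≠ v)
    (h : ¬ NonInv z u v) : bruhatLE (z * Equiv.swap u v) z := by
  have := bruhatLE_mul_swap_s12 (nonInv_mul_swap huv h)
  rwa [mul_assoc, Equiv.swap_mul_self, mul_one] at this

theorem bruhatLE.trans {n : ℕ} {x y z : Equiv.Perm (Fin n)} (hxy : bruhatLE x y)
    (hyz : bruhatLE y z) : bruhatLE x z := by
  intro p q
  have h1 := hxy p q
  have h2 := hyz p q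
  unfold dxw at *
  omega

theorem mem_Delta_of_nonInv {n : ℕ} {x w : Equiv.Perm (Fin n)} {i k : Fin n}
    (h : NonInv x i k) (hle : bruhatLE (x * Equiv.swap i k) w) : i ∈ Delta x w := by
  refine ⟨k, ⟨i, k, ?_, rfl⟩, invLen_lt_mul_swap_s12 h, hle⟩
  rintro rfl
  simp [NonInv] at h

/-- If `i ↔ a` is a length-increasing swap of `y` staying below `w` and `a ↔ b` is a
length-decreasing one, then `i` still takes part in a length-increasing swap of
`y * swap a b` staying below `w`. -/
theorem mem_Delta_mul_swap {n : ℕ} {y w : Equiv.Perm (Fin n)} {i a b : Fin n}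
    (hab : a ≠ b) (hia : i ≠ a) (hib : i ≠ b) (hdesc : ¬ NonInv y a b)
    (hasc : NonInv y i a) (hle : bruhatLE (y * Equiv.swap i a) w) :
    i ∈ Delta (y * Equiv.swap a b) w := by
  have e1 : y * Equiv.swap a b * Equiv.swap i b = y * Equiv.swap i a * Equiv.swap a b := by
    ext c
    simp only [Equiv.Perm.mul_apply, Equiv.swap_apply_def]
    grind
  have e2 : y * Equiv.swap a b * Equiv.swap i a = y * Equiv.swap i a * Equiv.swap i b := by
    ext c
    simp only [Equiv.Perm.mul_apply, Equiv.swap_apply_def]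
    grind
  have hya : y a ≠ y b := fun e => hab (y.injective e)
  have hyi : y i ≠ y a := fun e => hia (y.injective e)
  have hyb : y i ≠ y b := fun e => hib (y.injective e)
  have key : (NonInv (y * Equiv.swap a b) i b ∧ ¬ NonInv (y * Equiv.swap i a) a b) ∨
      (NonInv (y * Equiv.swap a b) i a ∧ ¬ NonInv (y * Equiv.swap i a) i b) := by
    simp only [NonInv, Equiv.Perm.mul_apply, Equiv.swap_apply_left, Equiv.swap_apply_right,
      Equiv.swap_apply_of_ne_of_ne hia hib,
      Equiv.swap_apply_of_ne_of_ne hib.symm hab.symm] at hdesc hasc ⊢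
    omega
  rcases key with ⟨h1, h2⟩ | ⟨h1, h2⟩
  · refine mem_Delta_of_nonInv h1 ?_
    rw [e1]
    exact (mul_swap_bruhatLE hab h2).trans hle
  · refine mem_Delta_of_nonInv h1 ?_
    rw [e2]
    exact (mul_swap_bruhatLE hib h2).trans hle

/-- If `y ≤ w` and `t` is a transposition with `l(yt) < l(y)`, then
`Δ(y,w) ⊆ Δ(yt,w)`. -/
theorem delta_subset {n : ℕ} (y w : Equiv.Perm (Fin n)) (hyw : bruhatLE y w)
    (t : Equiv.Perm (Fin n)) (ht : t ∈ transpositions n)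
    (hlt : invLen (y * t) < invLen y) :
    Delta y w ⊆ Delta (y * t) w := by
  obtain ⟨a, b, hab, rfl⟩ := ht
  rintro i ⟨j, -, hlen, hle⟩
  have hasc : NonInv y i j := nonInv_of_invLen_lt hlen
  have hdesc : ¬ NonInv y a b := fun h => (invLen_lt_mul_swap_s12 h).not_gt hlt
  have hasc' : NonInv (y * Equiv.swap a b) a b := nonInv_mul_swap hab hdesc
  have hback : y * Equiv.swap a b * Equiv.swap a b = y := by
    rw [mul_assoc, Equiv.swap_mul_self, mul_one]
  by_cases hia : i = a
  · subst hia
    exact mem_Delta_of_nonInv hasc' (by rwa [hback])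
  by_cases hib : i = b
  · subst hib
    exact mem_Delta_of_nonInv hasc'.symm (by rwa [Equiv.swap_comm i a, hback])
  by_cases hja : j = a
  · subst hja
    exact mem_Delta_mul_swap hab hia hib hdesc hasc hle
  by_cases hjb : j = b
  · subst hjb
    rw [Equiv.swap_comm a j]
    exact mem_Delta_mul_swap hab.symm hib hia (fun h => hdesc h.symm) hasc hle
  have hij : i ≠ j := by
    rintro rfl
    simp [NonInv] at hasc
  have hcomm : y * Equiv.swap a b * Equiv.swap i j = y * Equiv.swap i j * Equiv.swap a b := by
    ext c
    simp only [Equiv.Perm.mul_apply, Equiv.swap_apply_def]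
    grind
  refine mem_Delta_of_nonInv (k := j) ?_ ?_
  · simpa only [NonInv, Equiv.Perm.mul_apply, Equiv.swap_apply_of_ne_of_ne hia hib,
      Equiv.swap_apply_of_ne_of_ne hja hjb] using hasc
  · rw [hcomm]
    refine (mul_swap_bruhatLE hab ?_).trans hle
    simpa only [NonInv, Equiv.Perm.mul_apply,
      Equiv.swap_apply_of_ne_of_ne (Ne.symm hia) (Ne.symm hja),
      Equiv.swap_apply_of_ne_of_ne (Ne.symm hib) (Ne.symm hjb)] using hdesc

end BSW
end

section
/- Let x, w ∈ S_n with x ≤ w, and let b ∈ {1,…,n} with x(b) ≠ w(b). Then: (1) if w(b) < x(b), there exists a < b with t_{a,b} ∈ R(x,w) and x(a) ≠ w(a); (2) if w(b) > x(b), there exists c > b with t_{b,c} ∈ R(x,w) and x(c) ≠ w(c). -/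
open scoped Classical

namespace BSW

theorem rank_eq_sum {n : ℕ} (w : Equiv.Perm (Fin n)) (p q : ℤ) :
    (rank w p q : ℤ) = ∑ i : Fin n,
      if ((i : ℕ) : ℤ) + 1 ≤ p ∧ q ≤ ((w i : ℕ) : ℤ) + 1 then (1 : ℤ) else 0 := by
  simp [rank]

theorem rank_mul_swap {n : ℕ} (x : Equiv.Perm (Fin n)) {a b : Fin n} (hab : a < b)
    (hx : x a < x b) (p q : ℤ) :
    (rank (x * Equiv.swap a b) p q : ℤ) = rank x p q +
      if (((a : ℕ) : ℤ) + 1 ≤ p ∧ p ≤ (b : ℕ)) ∧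
        (((x a : ℕ) : ℤ) + 1 < q ∧ q ≤ ((x b : ℕ) : ℤ) + 1) then 1 else 0 := by
  have hab' : (a : ℕ) < b := hab
  have hx' : (x a : ℕ) < x b := hx
  have key : ∀ i : Fin n,
      (if ((Equiv.swap a b i : ℕ) : ℤ) + 1 ≤ p ∧
        q ≤ (((x * Equiv.swap a b) (Equiv.swap a b i) : ℕ) : ℤ) + 1 then (1 : ℤ) else 0) =
      (if ((i : ℕ) : ℤ) + 1 ≤ p ∧ q ≤ ((x i : ℕ) : ℤ) + 1 then (1 : ℤ) else 0) +
      ((if i = b then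
        (if (((a : ℕ) : ℤ) + 1 ≤ p ∧ p ≤ (b : ℕ)) ∧ q ≤ ((x b : ℕ) : ℤ) + 1 then 1 else 0)
        else 0) -
      (if i = a then
        (if (((a : ℕ) : ℤ) + 1 ≤ p ∧ p ≤ (b : ℕ)) ∧ q ≤ ((x a : ℕ) : ℤ) + 1 then 1 else 0)
        else 0)) := by
    intro i
    rw [Equiv.Perm.mul_apply, Equiv.swap_apply_self]
    by_cases hia : i = a
    · subst hia
      rw [Equiv.swap_apply_left, if_neg hab.ne, if_pos rfl]
      split_ifs <;> omega
    · by_cases hib : i = b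
      · subst hib
        rw [Equiv.swap_apply_right, if_pos rfl, if_neg hia]
        split_ifs <;> omega
      · rw [Equiv.swap_apply_of_ne_of_ne hia hib, if_neg hib, if_neg hia]
        simp
  rw [rank_eq_sum, rank_eq_sum, ← Equiv.sum_comp (Equiv.swap a b), Finset.sum_congr rfl
    (fun i _ => key i), Finset.sum_add_distrib, Finset.sum_sub_distrib,
    Finset.sum_ite_eq', Finset.sum_ite_eq']
  simp only [Finset.mem_univ, if_true]
  congr 1
  split_ifs <;> omega

theorem invLen_lt_invLen_mul_swap {n : ℕ} (x : Equiv.Perm (Fin n)) {a b : Fin n} (hab : a < b)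
    (hx : x a < x b) : invLen x < invLen (x * Equiv.swap a b) := by
  set t := Equiv.swap a b
  have htt : ∀ i, t (t i) = i := fun i => Equiv.swap_apply_self a b i
  have hta : t a = b := Equiv.swap_apply_left a b
  have htb : t b = a := Equiv.swap_apply_right a b
  have hto : ∀ i, i ≠ a → i ≠ b → t i = i := fun i => Equiv.swap_apply_of_ne_of_ne
  let f : Fin n × Fin n → Fin n × Fin n :=
    fun p => if t p.1 < t p.2 then (t p.1, t p.2) else p
  have hmem : (a, b) ∈ Finset.univ.filter
      (fun p : Fin n × Fin n => p.1 < p.2 ∧ (x * t) p.2 < (x * t) p.1) := by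
    refine Finset.mem_filter.2 ⟨Finset.mem_univ _, hab, ?_⟩
    rwa [Equiv.Perm.mul_apply, Equiv.Perm.mul_apply, hta, htb]
  unfold invLen
  refine lt_of_le_of_lt ?_ (Finset.card_erase_lt_of_mem hmem)
  refine Finset.card_le_card_of_injOn f ?_ ?_
  · rintro ⟨i, j⟩ hij
    simp only [Finset.coe_filter, Finset.mem_univ, true_and, Set.mem_ofPred_eq] at hij
    simp only [Finset.coe_erase, Set.mem_sdiff, Set.mem_singleton_iff, Equiv.Perm.mul_apply, f]
    grind
  · rintro ⟨i, j⟩ hij ⟨k, l⟩ hkl h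
    simp only [Finset.coe_filter, Finset.mem_univ, true_and, Set.mem_ofPred_eq] at hij hkl
    simp only [f] at h
    grind

theorem swap_mem_R {n : ℕ} {x w : Equiv.Perm (Fin n)} (hxw : bruhatLE x w) {a b : Fin n}
    (hab : a < b) (hx : x a < x b)
    (hd : ∀ p q : ℤ, ((a : ℕ) : ℤ) + 1 ≤ p → p ≤ (b : ℕ) → ((x a : ℕ) : ℤ) + 1 < q →
      q ≤ ((x b : ℕ) : ℤ) + 1 → dxw x w p q ≠ 0) :
    Equiv.swap a b ∈ R x w := by
  refine ⟨⟨a, b, hab.ne, rfl⟩, invLen_lt_invLen_mul_swap x hab hx, fun p q => ?_⟩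
  have h0 := hxw p q
  have h1 := hd p q
  unfold dxw at *
  rw [rank_mul_swap x hab hx]
  split_ifs with h
  · have := h1 h.1.1 h.1.2 h.2.1 h.2.2
    omega
  · omega

/-- If the mixed difference of `d_{x,w}` over a rectangle is negative, then some point of the
graph of `x` in that rectangle is not on the graph of `w`. -/
theorem exists_mem_rectangle_of_dxw_lt {n : ℕ} {x w : Equiv.Perm (Fin n)} {p₁ p₂ q₁ q₂ : ℤ}
    (hp : p₁ ≤ p₂) (hq : q₁ ≤ q₂)
    (h : dxw x w p₂ q₁ + dxw x w p₁ q₂ < dxw x w p₁ q₁ + dxw x w p₂ q₂) :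
    ∃ i : Fin n, (p₁ < ((i : ℕ) : ℤ) + 1 ∧ ((i : ℕ) : ℤ) + 1 ≤ p₂) ∧
      (q₁ ≤ ((x i : ℕ) : ℤ) + 1 ∧ ((x i : ℕ) : ℤ) + 1 < q₂) ∧ x i ≠ w i := by
  contrapose! h
  simp only [dxw, rank_eq_sum, ← Finset.sum_sub_distrib, ← Finset.sum_add_distrib]
  refine Finset.sum_le_sum fun i _ => ?_
  by_cases hi : x i = w i
  · simp [hi]
  · have := mt (fun H : (p₁ < ((i : ℕ) : ℤ) + 1 ∧ ((i : ℕ) : ℤ) + 1 ≤ p₂) ∧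
      (q₁ ≤ ((x i : ℕ) : ℤ) + 1 ∧ ((x i : ℕ) : ℤ) + 1 < q₂) => h i H.1 H.2) hi
    split_ifs <;> omega

/-- Passing from column `b` to column `b + 1` changes `d_{x,w}` by the contribution of
position `b`. -/
theorem dxw_succ {n : ℕ} (x w : Equiv.Perm (Fin n)) (b : Fin n) (q : ℤ) :
    dxw x w ((b : ℕ) + 1) q = dxw x w (b : ℕ) q +
      ((if q ≤ ((w b : ℕ) : ℤ) + 1 then 1 else 0) -
        (if q ≤ ((x b : ℕ) : ℤ) + 1 then 1 else 0)) := by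
  have key : ∀ v : Equiv.Perm (Fin n), (rank v ((b : ℕ) + 1) q : ℤ) = rank v (b : ℕ) q +
      (if q ≤ ((v b : ℕ) : ℤ) + 1 then 1 else 0) := by
    intro v
    have : (if q ≤ ((v b : ℕ) : ℤ) + 1 then (1 : ℤ) else 0) = ∑ i : Fin n,
        if i = b then (if q ≤ ((v b : ℕ) : ℤ) + 1 then (1 : ℤ) else 0) else 0 := by
      simp
    rw [this, rank_eq_sum, rank_eq_sum, ← Finset.sum_add_distrib]
    refine Finset.sum_congr rfl fun i _ => ?_
    by_cases hi : i = b
    · subst hi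
      rw [if_pos rfl]
      split_ifs <;> omega
    · have : (i : ℕ) ≠ b := fun h => hi (Fin.ext h)
      rw [if_neg hi]
      split_ifs <;> omega
  simp only [dxw, key]
  ring

theorem dxw_zero_left {n : ℕ} (x w : Equiv.Perm (Fin n)) (q : ℤ) : dxw x w 0 q = 0 := by
  simp only [dxw, rank_eq_sum, ← Finset.sum_sub_distrib]
  refine Finset.sum_eq_zero fun i _ => ?_
  split_ifs <;> omega

theorem dxw_zero_right {n : ℕ} (x w : Equiv.Perm (Fin n)) (p : ℤ) : dxw x w p 0 = 0 := by
  simp only [dxw, rank_eq_sum, ← Finset.sum_sub_distrib]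
  refine Finset.sum_eq_zero fun i _ => ?_
  split_ifs <;> omega

theorem dxw_card_left {n : ℕ} (x w : Equiv.Perm (Fin n)) (q : ℤ) : dxw x w n q = 0 := by
  have key : ∀ v : Equiv.Perm (Fin n), (rank v n q : ℤ) =
      ∑ i : Fin n, if q ≤ ((i : ℕ) : ℤ) + 1 then (1 : ℤ) else 0 := by
    intro v
    rw [rank_eq_sum, ← Equiv.sum_comp v
      (fun i : Fin n => if q ≤ ((i : ℕ) : ℤ) + 1 then (1 : ℤ) else 0)]
    refine Finset.sum_congr rfl fun i _ => ?_
    have := i.isLt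
    split_ifs <;> omega
  simp [dxw, key]

theorem dxw_card_succ_right {n : ℕ} (x w : Equiv.Perm (Fin n)) (p : ℤ) :
    dxw x w p (n + 1) = 0 := by
  simp only [dxw, rank_eq_sum, ← Finset.sum_sub_distrib]
  refine Finset.sum_eq_zero fun i _ => ?_
  have := (x i).isLt
  have := (w i).isLt
  split_ifs <;> omega

/-- If `x ≤ w` and `x(b) ≠ w(b)`, then: (1) if `w(b) < x(b)` there is `a < b` with
`t_{a,b} ∈ R(x,w)` and `x(a) ≠ w(a)`; (2) if `w(b) > x(b)` there is `c > b` with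
`t_{b,c} ∈ R(x,w)` and `x(c) ≠ w(c)`. -/
theorem exists_reflection_at_difference {n : ℕ} (x w : Equiv.Perm (Fin n))
    (hxw : bruhatLE x w) (b : Fin n) (hb : x b ≠ w b) :
    (w b < x b → ∃ a : Fin n, a < b ∧ Equiv.swap a b ∈ R x w ∧ x a ≠ w a) ∧
      (x b < w b → ∃ c : Fin n, b < c ∧ Equiv.swap b c ∈ R x w ∧ x c ≠ w c) := by
  constructor
  · intro hlt
    have hlt' : (w b : ℕ) < x b := hlt
    have hpos : dxw x w (b : ℕ) ((x b : ℕ) + 1) ≠ 0 := by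
      have h0 := hxw ((b : ℕ) + 1) ((x b : ℕ) + 1)
      rw [dxw_succ, if_neg (by omega), if_pos le_rfl] at h0
      omega
    obtain ⟨s, ⟨hs, hs0⟩, hsmax⟩ := Int.exists_greatest_of_bdd
      (P := fun q => q ≤ (x b : ℕ) + 1 ∧ dxw x w (b : ℕ) q = 0)
      ⟨_, fun _ h => h.1⟩ ⟨0, by omega, dxw_zero_right x w _⟩
    have hs' : s < (x b : ℕ) + 1 := lt_of_le_of_ne hs (by rintro rfl; exact hpos hs0)
    obtain ⟨p, ⟨hpb, m, hsm, hmx, hm0⟩, hpmax⟩ := Int.exists_greatest_of_bdd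
      (P := fun p => p ≤ (b : ℕ) ∧ ∃ m, s < m ∧ m ≤ (x b : ℕ) + 1 ∧ dxw x w p m = 0)
      ⟨_, fun _ h => h.1⟩ ⟨0, by omega, _, hs', le_rfl, dxw_zero_left x w _⟩
    have hbm : dxw x w (b : ℕ) m ≠ 0 := fun h => absurd (hsmax m ⟨hmx, h⟩) (by omega)
    obtain ⟨a, ⟨hpa, hab⟩, ⟨hsa, ham⟩, hne⟩ := exists_mem_rectangle_of_dxw_lt
      (x := x) (w := w) hpb hsm.le (by
        have h1 := hxw (b : ℕ) m
        have h2 := hxw p s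
        omega)
    have hab' : a < b := Fin.lt_def.2 (by omega)
    refine ⟨a, hab', swap_mem_R hxw hab' (Fin.lt_def.2 (by omega)) ?_, hne⟩
    intro p' q' h1 h2 h3 h4 h0
    have := hpmax p' ⟨h2, q', by omega, h4, h0⟩
    omega
  · intro hlt
    have hlt' : (x b : ℕ) < w b := hlt
    have hpos : dxw x w ((b : ℕ) + 1) ((x b : ℕ) + 2) ≠ 0 := by
      have h0 := hxw (b : ℕ) ((x b : ℕ) + 2)
      rw [dxw_succ, if_pos (by omega), if_neg (by omega)]
      omega
    obtain ⟨s, ⟨hs, hs0⟩, hsmin⟩ := Int.exists_least_of_bdd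
      (P := fun q => (x b : ℕ) + 2 ≤ q ∧ dxw x w ((b : ℕ) + 1) q = 0)
      ⟨_, fun _ h => h.1⟩ ⟨n + 1, by omega, dxw_card_succ_right x w _⟩
    have hs' : (x b : ℕ) + 2 < s := lt_of_le_of_ne hs (by rintro rfl; exact hpos hs0)
    obtain ⟨p, ⟨hbp, m, hms, hxm, hm0⟩, hpmin⟩ := Int.exists_least_of_bdd
      (P := fun p => (b : ℕ) + 1 ≤ p ∧ ∃ m, m < s ∧ (x b : ℕ) + 2 ≤ m ∧ dxw x w p m = 0)
      ⟨_, fun _ h => h.1⟩ ⟨n, by omega, _, hs', le_rfl, dxw_card_left x w _⟩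
    have hbm : dxw x w ((b : ℕ) + 1) m ≠ 0 := fun h => absurd (hsmin m ⟨hxm, h⟩) (by omega)
    obtain ⟨c, ⟨hbc, hcp⟩, ⟨hmc, hcs⟩, hne⟩ := exists_mem_rectangle_of_dxw_lt
      (x := x) (w := w) hbp hms.le (by
        have h1 := hxw ((b : ℕ) + 1) m
        have h2 := hxw p s
        omega)
    have hbc' : b < c := Fin.lt_def.2 (by omega)
    refine ⟨c, hbc', swap_mem_R hxw hbc' (Fin.lt_def.2 (by omega)) ?_, hne⟩
    intro p' q' h1 h2 h3 h4 h0
    have := hpmin p' ⟨h1, q', by omega, by omega, h0⟩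
    omega

end BSW
end
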